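/- arXiv:1405.1840 — 4 statements merged into one kernel-verified Lean document; each statement's English description precedes it below -/
import Mathlib

section
/- Let (𝓑; B₁, B₂) be a boundary triplet for A₀* and let A be the restriction of A₀* to a subspace 𝓓 with Ker(B₁) ∩ Ker(B₂) ⊆ 𝓓 ⊆ dom(A₀*), and set 𝓒 := {(B₁d, B₂d) : d ∈ 𝓓}. Then: (i) A is dissipative if and only if 𝓒 is a dissipative relation in 𝓑, and A is maximal dissipative if and only if 𝓒 is a maximal dissipative relation in 𝓑; (ii) A is maximal dissipative if and only if there exists a contraction V ∈ 𝓛(𝓑) (a bounded operator with ‖V‖ ≤ 1) such that 𝓒 = { (f, e) ∈ 𝓑 × 𝓑 : (I + V)f + (I − V)e = 0 }. -/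
open scoped ComplexInnerProductSpace

noncomputable section

/-- A boundary triplet `(𝓑; B₁, B₂)` for the operator `T` (to be taken as `T = A₀*`):
a Hilbert space `B` and two linear maps `B₁ B₂ : dom T → B`, bounded with respect to the
graph norm of `T`, such that `x ↦ (B₁ x, B₂ x)` is onto `B × B` and the abstract Green
identity `⟪Tx, x̃⟫ + ⟪x, Tx̃⟫ = ⟪B₁x, B₂x̃⟫ + ⟪B₂x, B₁x̃⟫` holds. -/
structure BoundaryTriplet {X : Type*} [NormedAddCommGroup X] [InnerProductSpace ℂ X]
    (B : Type*) [NormedAddCommGroup B] [InnerProductSpace ℂ B]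
    (T : X →ₗ.[ℂ] X) where
  B₁ : T.domain →ₗ[ℂ] B
  B₂ : T.domain →ₗ[ℂ] B
  bounded₁ : ∃ C : ℝ, ∀ x : T.domain, ‖B₁ x‖ ≤ C * (‖(x : X)‖ + ‖T x‖)
  bounded₂ : ∃ C : ℝ, ∀ x : T.domain, ‖B₂ x‖ ≤ C * (‖(x : X)‖ + ‖T x‖)
  surjective : Function.Surjective fun x : T.domain => (B₁ x, B₂ x)
  green : ∀ x y : T.domain,
    ⟪T x, (y : X)⟫ + ⟪(x : X), T y⟫ = ⟪B₁ x, B₂ y⟫ + ⟪B₂ x, B₁ y⟫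

/-- A relation `R` in a Hilbert space `H` (a linear subspace of `H × H`) is dissipative
if `Re ⟪r₁, r₂⟫ ≤ 0` for all `(r₁, r₂) ∈ R`. -/
def IsDissipativeRel {H : Type*} [NormedAddCommGroup H] [InnerProductSpace ℂ H]
    (R : Submodule ℂ (H × H)) : Prop :=
  ∀ r ∈ R, (⟪r.1, r.2⟫ : ℂ).re ≤ 0

/-- A relation is maximal dissipative if it is dissipative and has no proper extension to a
dissipative relation. -/
def IsMaximalDissipativeRel {H : Type*} [NormedAddCommGroup H] [InnerProductSpace ℂ H]
    (R : Submodule ℂ (H × H)) : Prop :=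
  IsDissipativeRel R ∧
    ∀ R' : Submodule ℂ (H × H), IsDissipativeRel R' → R ≤ R' → R' = R

section Dissipative

variable {H : Type*} [NormedAddCommGroup H] [InnerProductSpace ℂ H]

/-- In a dissipative relation, an element with `Re ⟪r₁, r₂⟫ = 0` is orthogonal to the whole
relation for the form `(r, s) ↦ ⟪r₁, s₂⟫ + ⟪r₂, s₁⟫`. -/
theorem IsDissipativeRel.inner_add_inner_eq_zero {R : Submodule ℂ (H × H)}
    (hR : IsDissipativeRel R) {r s : H × H} (hr : r ∈ R) (hs : s ∈ R)
    (h0 : (⟪r.1, r.2⟫ : ℂ).re = 0) : (⟪r.1, s.2⟫ : ℂ) + ⟪r.2, s.1⟫ = 0 := by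
  set z : ℂ := (⟪r.1, s.2⟫ : ℂ) + ⟪r.2, s.1⟫ with hz
  have key : ∀ c : ℝ, (⟪s.1, s.2⟫ : ℂ).re + c * Complex.normSq z ≤ 0 := by
    intro c
    have h := hR _ (R.add_mem hs (R.smul_mem ((c : ℂ) * z) hr))
    have hflip : (⟪s.1, r.2⟫ : ℂ) = starRingEnd ℂ ⟪r.2, s.1⟫ := (inner_conj_symm _ _).symm
    simp only [Prod.fst_add, Prod.snd_add, Prod.smul_fst, Prod.smul_snd, inner_add_left,
      inner_add_right, inner_smul_left, inner_smul_right, hflip] at h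
    have hre : z.re = (⟪r.1, s.2⟫ : ℂ).re + (⟪r.2, s.1⟫ : ℂ).re := by simp [hz]
    have him : z.im = (⟪r.1, s.2⟫ : ℂ).im + (⟪r.2, s.1⟫ : ℂ).im := by simp [hz]
    simp only [map_mul, Complex.add_re, Complex.add_im, Complex.mul_re, Complex.mul_im, Complex.conj_re,
      Complex.conj_im, Complex.ofReal_re, Complex.ofReal_im, h0] at h
    rw [Complex.normSq_apply]
    linear_combination h + c * z.re * hre + c * z.im * him
  by_contra hne
  have hpos : 0 < Complex.normSq z := Complex.normSq_pos.mpr hne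
  have h := key ((1 - (⟪s.1, s.2⟫ : ℂ).re) / Complex.normSq z)
  rw [div_mul_cancel₀ _ hpos.ne'] at h
  linarith

theorem re_inner_nonpos_iff_norm_add_le_norm_sub (f e : H) :
    (⟪f, e⟫ : ℂ).re ≤ 0 ↔ ‖f + e‖ ≤ ‖f - e‖ := by
  have h₁ := norm_add_sq (𝕜 := ℂ) f e
  have h₂ := norm_sub_sq (𝕜 := ℂ) f e
  rw [← sq_le_sq₀ (norm_nonneg _) (norm_nonneg _), h₁, h₂]
  simp only [RCLike.re_to_complex]
  constructor <;> intro h <;> linarith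

theorem isDissipativeRel_iff_norm_add_le_norm_sub {R : Submodule ℂ (H × H)} :
    IsDissipativeRel R ↔ ∀ r ∈ R, ‖r.1 + r.2‖ ≤ ‖r.1 - r.2‖ :=
  forall₂_congr fun _ _ => re_inner_nonpos_iff_norm_add_le_norm_sub _ _

theorem IsDissipativeRel.topologicalClosure {R : Submodule ℂ (H × H)}
    (hR : IsDissipativeRel R) : IsDissipativeRel R.topologicalClosure := by
  have hcl : IsClosed {r : H × H | (⟪r.1, r.2⟫ : ℂ).re ≤ 0} :=
    isClosed_le (Complex.continuous_re.comp (continuous_fst.inner continuous_snd))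
      continuous_const
  exact fun r hr => closure_minimal (fun x hx => hR x hx) hcl hr

theorem IsMaximalDissipativeRel.isClosed {R : Submodule ℂ (H × H)}
    (hR : IsMaximalDissipativeRel R) : IsClosed (R : Set (H × H)) := by
  rw [← hR.2 _ hR.1.topologicalClosure R.le_topologicalClosure]
  exact R.isClosed_topologicalClosure

theorem add_apply_add_sub_apply_eq_zero_iff (V : H →L[ℂ] H) (f e : H) :
    (1 + V) f + (1 - V) e = 0 ↔ f + e = -V (f - e) := by
  rw [eq_neg_iff_add_eq_zero]
  simp only [add_apply, sub_apply, one_apply_eq_self,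
    map_sub]
  constructor <;> intro h <;> rw [← h] <;> abel

theorem isMaximalDissipativeRel_of_contraction {R : Submodule ℂ (H × H)} {V : H →L[ℂ] H}
    (hV : ‖V‖ ≤ 1)
    (hR : (R : Set (H × H)) = {p : H × H | (1 + V) p.1 + (1 - V) p.2 = 0}) :
    IsMaximalDissipativeRel R := by
  have hmem : ∀ p : H × H, p ∈ R ↔ p.1 + p.2 = -V (p.1 - p.2) := fun p => by
    rw [← SetLike.mem_coe, hR]
    exact add_apply_add_sub_apply_eq_zero_iff V p.1 p.2
  refine ⟨isDissipativeRel_iff_norm_add_le_norm_sub.mpr fun p hp => ?_, fun R' hR' hle => ?_⟩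
  · rw [(hmem p).mp hp, norm_neg]
    exact V.le_of_opNorm_le_of_le hV le_rfl |>.trans_eq (one_mul _)
  refine le_antisymm (fun p hp => ?_) hle
  set a := p.1 - p.2
  let q : H × H := ((2⁻¹ : ℂ) • (-V a + a), (2⁻¹ : ℂ) • (-V a - a))
  have hsub : q.1 - q.2 = a := by simp only [q]; module
  have hadd : q.1 + q.2 = -V a := by simp only [q]; module
  have hq : q ∈ R := by rw [hmem, hsub, hadd]
  have h := isDissipativeRel_iff_norm_add_le_norm_sub.mp hR' _ (R'.sub_mem hp (hle hq))
  have h₁ : (p - q).1 - (p - q).2 = 0 := by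
    have : (p - q).1 - (p - q).2 = (p.1 - p.2) - (q.1 - q.2) := by
      simp only [Prod.fst_sub, Prod.snd_sub]; abel
    rw [this, hsub, sub_self]
  have h₂ : (p - q).1 + (p - q).2 = (p.1 + p.2) - (q.1 + q.2) := by
    simp only [Prod.fst_sub, Prod.snd_sub]; abel
  rw [h₁, norm_zero, norm_le_zero_iff, h₂, hadd, sub_eq_zero] at h
  exact (hmem p).mpr h

theorem IsMaximalDissipativeRel.exists_contraction [CompleteSpace H]
    {R : Submodule ℂ (H × H)} (hR : IsMaximalDissipativeRel R) :
    ∃ V : H →L[ℂ] H, ‖V‖ ≤ 1 ∧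
      (R : Set (H × H)) = {p : H × H | (1 + V) p.1 + (1 - V) p.2 = 0} := by
  have hdis := isDissipativeRel_iff_norm_add_le_norm_sub.mp hR.1
  have : CompleteSpace R := hR.isClosed.completeSpace_coe
  let φ : R →L[ℂ] H :=
    (ContinuousLinearMap.fst ℂ H H - ContinuousLinearMap.snd ℂ H H).comp R.subtypeL
  let ψ : R →ₗ[ℂ] H := (LinearMap.fst ℂ H H + LinearMap.snd ℂ H H) ∘ₗ R.subtype
  have hφ : ∀ r : R, φ r = (r : H × H).1 - (r : H × H).2 := fun _ => rfl
  have hψ : ∀ r : R, ψ r = (r : H × H).1 + (r : H × H).2 := fun _ => rfl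
  have hψφ : ∀ r : R, ‖ψ r‖ ≤ ‖φ r‖ := fun r => hdis r r.2
  have hanti : AntilipschitzWith 1 φ := by
    refine AddMonoidHomClass.antilipschitz_of_bound φ fun r => ?_
    have h₁ : ‖(r : H × H).1‖ ≤ ‖φ r‖ := by
      have : (r : H × H).1 = (2⁻¹ : ℂ) • (ψ r + φ r) := by rw [hφ, hψ]; module
      rw [this, norm_smul]
      have := norm_add_le (ψ r) (φ r)
      have := hψφ r
      norm_num; linarith
    have h₂ : ‖(r : H × H).2‖ ≤ ‖φ r‖ := by
      have : (r : H × H).2 = (2⁻¹ : ℂ) • (ψ r - φ r) := by rw [hφ, hψ]; module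
      rw [this, norm_smul]
      have := norm_sub_le (ψ r) (φ r)
      have := hψφ r
      norm_num; linarith
    rw [NNReal.coe_one, one_mul]
    exact max_le h₁ h₂
  let S : Submodule ℂ H := LinearMap.range (φ : R →ₗ[ℂ] H)
  have : CompleteSpace S := (hanti.isClosed_range φ.uniformContinuous).completeSpace_coe
  let Φ : R ≃ₗ[ℂ] S := LinearEquiv.ofInjective (φ : R →ₗ[ℂ] H) hanti.injective
  have hΦ : ∀ r : R, (Φ r : H) = φ r := fun _ => rfl
  let V₀ : H →ₗ[ℂ] H := -(ψ ∘ₗ Φ.symm.toLinearMap ∘ₗ S.orthogonalProjectionOnto.toLinearMap)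
  have hV₀ : ∀ a : H, ‖V₀ a‖ ≤ 1 * ‖a‖ := fun a => by
    have h : φ (Φ.symm (S.orthogonalProjectionOnto a)) = S.orthogonalProjectionOnto a := by
      rw [← hΦ, Φ.apply_symm_apply]
    calc ‖V₀ a‖ = ‖ψ (Φ.symm (S.orthogonalProjectionOnto a))‖ := norm_neg _
      _ ≤ ‖(S.orthogonalProjectionOnto a : H)‖ := h ▸ hψφ _
      _ ≤ 1 * ‖a‖ := by
        rw [one_mul]; exact S.norm_orthogonalProjectionOnto_apply_le a
  let V : H →L[ℂ] H := V₀.mkContinuous 1 hV₀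
  have hV : ‖V‖ ≤ 1 := V₀.mkContinuous_norm_le zero_le_one hV₀
  let R' : Submodule ℂ (H × H) :=
    LinearMap.ker (((1 + V).coprod (1 - V) : H × H →L[ℂ] H) : H × H →ₗ[ℂ] H)
  have hR' : (R' : Set (H × H)) = {p : H × H | (1 + V) p.1 + (1 - V) p.2 = 0} := rfl
  refine ⟨V, hV, ?_⟩
  rw [← hR', hR.2 R' (isMaximalDissipativeRel_of_contraction hV hR').1]
  intro p hp
  refine (add_apply_add_sub_apply_eq_zero_iff V p.1 p.2).mpr ?_
  have hproj : S.orthogonalProjectionOnto (p.1 - p.2) = Φ ⟨p, hp⟩ :=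
    S.orthogonalProjectionOnto_mem_subspace_eq_self (Φ ⟨p, hp⟩)
  have : V (p.1 - p.2) = -ψ (Φ.symm (S.orthogonalProjectionOnto (p.1 - p.2))) := rfl
  rw [this, hproj, Φ.symm_apply_apply, neg_neg, hψ]

/-- Maximal dissipative relations are the kernels of `[I + V, I - V]` for contractions `V`. -/
theorem isMaximalDissipativeRel_iff_exists_contraction [CompleteSpace H]
    {R : Submodule ℂ (H × H)} :
    IsMaximalDissipativeRel R ↔ ∃ V : H →L[ℂ] H, ‖V‖ ≤ 1 ∧
      (R : Set (H × H)) = {p : H × H | (1 + V) p.1 + (1 - V) p.2 = 0} :=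
  ⟨fun h => h.exists_contraction,
    fun ⟨_, hV, hR⟩ => isMaximalDissipativeRel_of_contraction hV hR⟩

end Dissipative

section BoundaryTriplet

variable {X : Type*} [NormedAddCommGroup X] [InnerProductSpace ℂ X]
  {B : Type*} [NormedAddCommGroup B] [InnerProductSpace ℂ B] {A₀ : X →ₗ.[ℂ] X}

theorem LinearPMap.graph_domRestrict_map_subtype (T : X →ₗ.[ℂ] X)
    (𝓓 : Submodule ℂ T.domain) :
    (T.domRestrict (𝓓.map T.domain.subtype)).graph =
      𝓓.map (T.domain.subtype.prod T.toFun) := by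
  ext p
  rw [LinearPMap.mem_graph_iff']
  constructor
  · rintro ⟨⟨x, ⟨d, hd, rfl⟩, hx⟩, rfl⟩
    exact ⟨d, hd, Prod.ext rfl (LinearPMap.domRestrict_apply rfl).symm⟩
  · rintro ⟨d, hd, rfl⟩
    exact ⟨⟨d, ⟨d, hd, rfl⟩, d.2⟩, Prod.ext rfl (LinearPMap.domRestrict_apply rfl)⟩

namespace BoundaryTriplet

theorem re_inner_apply {T : X →ₗ.[ℂ] X} (BT : BoundaryTriplet B T) (x : T.domain) :
    (⟪(x : X), T x⟫ : ℂ).re = (⟪BT.B₁ x, BT.B₂ x⟫ : ℂ).re := by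
  have h := congrArg Complex.re (BT.green x x)
  have h₁ := inner_re_symm (𝕜 := ℂ) (T x) (x : X)
  have h₂ := inner_re_symm (𝕜 := ℂ) (BT.B₂ x) (BT.B₁ x)
  simp only [Complex.add_re, RCLike.re_to_complex] at h h₁ h₂
  linarith

theorem isDissipativeRel_map_iff {T : X →ₗ.[ℂ] X} (BT : BoundaryTriplet B T)
    (𝓓 : Submodule ℂ T.domain) :
    IsDissipativeRel (𝓓.map (T.domain.subtype.prod T.toFun)) ↔
      IsDissipativeRel (𝓓.map (BT.B₁.prod BT.B₂)) := by
  simp only [IsDissipativeRel, Submodule.mem_map, forall_exists_index, and_imp,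
    forall_apply_eq_imp_iff₂]
  exact forall₂_congr fun x _ =>
    iff_of_eq (congrArg (· ≤ 0) (BT.re_inner_apply x))

theorem prod_surjective {T : X →ₗ.[ℂ] X} (BT : BoundaryTriplet B T) :
    Function.Surjective (BT.B₁.prod BT.B₂) :=
  BT.surjective

theorem eq_zero_of_forall_green_eq_zero {T : X →ₗ.[ℂ] X} (BT : BoundaryTriplet B T)
    {x : T.domain} (h : ∀ y : T.domain, (⟪T x, (y : X)⟫ : ℂ) + ⟪(x : X), T y⟫ = 0) :
    BT.B₁ x = 0 ∧ BT.B₂ x = 0 := by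
  obtain ⟨y, hy⟩ := BT.surjective (BT.B₂ x, BT.B₁ x)
  obtain ⟨hy₁, hy₂⟩ := Prod.mk.inj hy
  have h' := congrArg Complex.re ((BT.green x y).symm.trans (h y))
  simp only [hy₁, hy₂, inner_self_eq_norm_sq_to_K, Complex.coe_algebraMap] at h'
  norm_cast at h'
  constructor <;> rw [← norm_eq_zero] <;>
    nlinarith [sq_nonneg ‖BT.B₁ x‖, sq_nonneg ‖BT.B₂ x‖]

end BoundaryTriplet

theorem LinearPMap.inner_add_inner_eq_zero_of_skew
    (hskew : ∀ x : A₀.domain, (⟪A₀ x, (x : X)⟫ : ℂ).re = 0) (x y : A₀.domain) :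
    (⟪(x : X), A₀ y⟫ : ℂ) + ⟪A₀ x, (y : X)⟫ = 0 := by
  have h : ∀ x : A₀.domain, (⟪(x : X), A₀ x⟫ : ℂ).re = 0 := fun x =>
    (inner_re_symm (𝕜 := ℂ) _ _).trans (hskew x)
  have hdis : IsDissipativeRel A₀.graph := fun r hr => by
    obtain ⟨x, rfl⟩ := A₀.mem_graph_iff'.mp hr
    exact (h x).le
  exact hdis.inner_add_inner_eq_zero (A₀.mem_graph x) (A₀.mem_graph y) (h x)

variable [CompleteSpace X]

theorem LinearPMap.exists_adjoint_eq_neg_of_skew (hdense : Dense (A₀.domain : Set X))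
    (hskew : ∀ x : A₀.domain, (⟪A₀ x, (x : X)⟫ : ℂ).re = 0) (x : A₀.domain) :
    ∃ x' : A₀.adjoint.domain, (x' : X) = x ∧ A₀.adjoint x' = -A₀ x := by
  have h : ∀ y : A₀.domain, (⟪-A₀ x, (y : X)⟫ : ℂ) = ⟪(x : X), A₀ y⟫ := fun y => by
    rw [inner_neg_left, neg_eq_iff_add_eq_zero, add_comm]
    exact inner_add_inner_eq_zero_of_skew hskew x y
  exact ⟨⟨x, mem_adjoint_domain_of_exists _ ⟨_, h⟩⟩, rfl, adjoint_apply_eq hdense _ h⟩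

/-- A dissipative relation extending `-A₀` is contained in the graph of `A₀*`. -/
theorem IsDissipativeRel.exists_adjoint_apply_eq (hdense : Dense (A₀.domain : Set X))
    (hskew : ∀ x : A₀.domain, (⟪A₀ x, (x : X)⟫ : ℂ).re = 0)
    {R : Submodule ℂ (X × X)} (hR : IsDissipativeRel R)
    (hle : ∀ x : A₀.domain, ((x : X), -A₀ x) ∈ R) {r : X × X} (hr : r ∈ R) :
    ∃ u : A₀.adjoint.domain, ((u : X), A₀.adjoint u) = r := by
  have h : ∀ x : A₀.domain, (⟪r.2, (x : X)⟫ : ℂ) = ⟪r.1, A₀ x⟫ := fun x => by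
    have h0 : (⟪(x : X), -A₀ x⟫ : ℂ).re = 0 := by
      rw [inner_neg_right, Complex.neg_re, neg_eq_zero]
      exact (inner_re_symm (𝕜 := ℂ) _ _).trans (hskew x)
    have h := hR.inner_add_inner_eq_zero (hle x) hr h0
    rw [inner_neg_left, ← sub_eq_add_neg, sub_eq_zero] at h
    rw [← inner_conj_symm, h, inner_conj_symm]
  exact ⟨⟨r.1, LinearPMap.mem_adjoint_domain_of_exists _ ⟨_, h⟩⟩,
    Prod.ext rfl (LinearPMap.adjoint_apply_eq hdense _ h)⟩

theorem BoundaryTriplet.isMaximalDissipativeRel_map_iff (hdense : Dense (A₀.domain : Set X))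
    (hskew : ∀ x : A₀.domain, (⟪A₀ x, (x : X)⟫ : ℂ).re = 0)
    (BT : BoundaryTriplet B A₀.adjoint) {𝓓 : Submodule ℂ A₀.adjoint.domain}
    (h𝓓 : LinearMap.ker BT.B₁ ⊓ LinearMap.ker BT.B₂ ≤ 𝓓) :
    IsMaximalDissipativeRel (𝓓.map (A₀.adjoint.domain.subtype.prod A₀.adjoint.toFun)) ↔
      IsMaximalDissipativeRel (𝓓.map (BT.B₁.prod BT.B₂)) := by
  set ι := A₀.adjoint.domain.subtype.prod A₀.adjoint.toFun
  set β := BT.B₁.prod BT.B₂ with hβ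
  have hι : Function.Injective ι := fun x y h => Subtype.ext (congrArg Prod.fst h)
  have hker : LinearMap.ker β ≤ 𝓓 := by rwa [hβ, LinearMap.ker_prod]
  constructor <;> rintro ⟨hdis, hmax⟩
  · refine ⟨(BT.isDissipativeRel_map_iff 𝓓).mp hdis, fun R' hR' hle => ?_⟩
    have hR'map : (R'.comap β).map β = R' :=
      Submodule.map_comap_eq_of_surjective BT.prod_surjective R'
    have h := hmax ((R'.comap β).map ι)
      ((BT.isDissipativeRel_map_iff _).mpr (hR'map.symm ▸ hR'))
      (Submodule.map_mono (Submodule.map_le_iff_le_comap.mp hle))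
    rw [← Submodule.map_injective_of_injective hι h, hR'map]
  · refine ⟨(BT.isDissipativeRel_map_iff 𝓓).mpr hdis, fun R' hR' hle => ?_⟩
    have hneg : ∀ x : A₀.domain, ((x : X), -A₀ x) ∈ R' := fun x => by
      obtain ⟨x', hx', hAx'⟩ := LinearPMap.exists_adjoint_eq_neg_of_skew hdense hskew x
      refine hle ⟨x', h𝓓 (BT.eq_zero_of_forall_green_eq_zero fun y => ?_),
        Prod.ext hx' hAx'⟩
      rw [hAx', hx', inner_neg_left, neg_add_eq_zero, ← inner_conj_symm,
        ← A₀.adjoint_isFormalAdjoint hdense y x, inner_conj_symm]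
    have hR'map : (R'.comap ι).map ι = R' := by
      refine Submodule.map_comap_eq_self fun r hr => ?_
      exact hR'.exists_adjoint_apply_eq hdense hskew hneg hr
    have h := hmax ((R'.comap ι).map β)
      ((BT.isDissipativeRel_map_iff _).mp (hR'map.symm ▸ hR'))
      (Submodule.map_mono (Submodule.map_le_iff_le_comap.mp hle))
    refine le_antisymm (fun r hr => ?_) hle
    rw [← hR'map] at hr
    obtain ⟨u, hu, rfl⟩ := hr
    have hu' : u ∈ (𝓓.map β).comap β := h ▸ Submodule.mem_map_of_mem hu
    rw [Submodule.comap_map_eq_self hker] at hu'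
    exact Submodule.mem_map_of_mem hu'

end BoundaryTriplet

/-- With `A` the restriction of `A₀*` to `𝓓 ⊇ ker B₁ ∩ ker B₂` and
`𝓒 := {(B₁ d, B₂ d) : d ∈ 𝓓}`: (i) `A` is (maximal) dissipative iff `𝓒` is a (maximal)
dissipative relation in `𝓑`; (ii) `A` is maximal dissipative iff there is a contraction
`V ∈ 𝓛(𝓑)` with `𝓒 = ker [I + V, I − V]`. -/
theorem statement3
    {X : Type*} [NormedAddCommGroup X] [InnerProductSpace ℂ X] [CompleteSpace X]
    {B : Type*} [NormedAddCommGroup B] [InnerProductSpace ℂ B] [CompleteSpace B]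
    (A₀ : X →ₗ.[ℂ] X) (hdense : Dense (A₀.domain : Set X)) (hclosed : A₀.IsClosed)
    (hskew : ∀ x : A₀.domain, (⟪A₀ x, (x : X)⟫ : ℂ).re = 0)
    (BT : BoundaryTriplet B A₀.adjoint)
    (𝓓 : Submodule ℂ A₀.adjoint.domain)
    (h𝓓 : LinearMap.ker BT.B₁ ⊓ LinearMap.ker BT.B₂ ≤ 𝓓)
    (A : X →ₗ.[ℂ] X)
    (hA : A = A₀.adjoint.domRestrict (𝓓.map A₀.adjoint.domain.subtype))
    (𝓒 : Submodule ℂ (B × B)) (h𝓒 : 𝓒 = 𝓓.map (BT.B₁.prod BT.B₂)) :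
    (IsDissipativeRel A.graph ↔ IsDissipativeRel 𝓒) ∧
      (IsMaximalDissipativeRel A.graph ↔ IsMaximalDissipativeRel 𝓒) ∧
      (IsMaximalDissipativeRel A.graph ↔
        ∃ V : B →L[ℂ] B, ‖V‖ ≤ 1 ∧
          (𝓒 : Set (B × B)) = {p : B × B | (1 + V) p.1 + (1 - V) p.2 = 0}) := by
  subst hA h𝓒
  rw [LinearPMap.graph_domRestrict_map_subtype]
  have hmax := BT.isMaximalDissipativeRel_map_iff hdense hskew h𝓓
  exact ⟨BT.isDissipativeRel_map_iff 𝓓, hmax,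
    hmax.trans isMaximalDissipativeRel_iff_exists_contraction⟩
end
end

section
/- Let (𝓑; B₁, B₂) be a boundary triplet for A₀* and let A be the restriction of A₀* to a subspace 𝓓 with Ker(B₁) ∩ Ker(B₂) ⊆ 𝓓 ⊆ dom(A₀*), and set 𝓒 := {(B₁d, B₂d) : d ∈ 𝓓}. Then A is skew-adjoint (A* = −A) if and only if 𝓒 equals the image of its orthogonal complement 𝓒^⊥ in 𝓑 × 𝓑 under the coordinate flip (q,p) ↦ (p,q), and this holds if and only if 𝓒 = { (f, e) ∈ 𝓑 × 𝓑 : (I + V)f + (I − V)e = 0 } for some unitary operator V on 𝓑. -/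
open scoped ComplexInnerProductSpace

noncomputable section

/-- The orthogonal complement of a relation `C ⊆ H × H` with respect to the natural inner
product `⟪(f, e), (q, p)⟫ = ⟪f, q⟫ + ⟪e, p⟫` on `H × H`. -/
def prodOrth {H : Type*} [NormedAddCommGroup H] [InnerProductSpace ℂ H]
    (C : Submodule ℂ (H × H)) : Submodule ℂ (H × H) where
  carrier := {p | ∀ c ∈ C, (⟪c.1, p.1⟫ : ℂ) + ⟪c.2, p.2⟫ = 0}
  add_mem' := by
    intro a b ha hb c hc
    simp only [Set.mem_setOf_eq] at *
    rw [Prod.fst_add, Prod.snd_add, inner_add_right, inner_add_right]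
    linear_combination ha c hc + hb c hc
  zero_mem' := by
    intro c hc
    simp
  smul_mem' := by
    intro m p hp c hc
    simp only [Set.mem_setOf_eq] at *
    rw [Prod.smul_fst, Prod.smul_snd, inner_smul_right, inner_smul_right]
    linear_combination m * hp c hc

theorem mem_map_prodComm_prodOrth {H : Type*} [NormedAddCommGroup H] [InnerProductSpace ℂ H]
    (C : Submodule ℂ (H × H)) (p : H × H) :
    p ∈ Submodule.map (LinearEquiv.prodComm ℂ H H : H × H →ₗ[ℂ] H × H) (prodOrth C) ↔
      ∀ c ∈ C, (⟪c.1, p.2⟫ : ℂ) + ⟪c.2, p.1⟫ = 0 := by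
  constructor
  · rintro ⟨q, hq, rfl⟩ c hc
    exact hq c hc
  · intro h
    exact ⟨(p.2, p.1), h, rfl⟩

/-- Polarization of the flip form `⟪f, p⟫ + ⟪e, q⟫` by the sum and difference coordinates. -/
theorem inner_add_sub_inner_sub {H : Type*} [NormedAddCommGroup H] [InnerProductSpace ℂ H]
    (c p : H × H) :
    (⟪c.1 + c.2, p.1 + p.2⟫ : ℂ) - ⟪c.1 - c.2, p.1 - p.2⟫ =
      2 * (⟪c.1, p.2⟫ + ⟪c.2, p.1⟫) := by
  simp only [inner_add_left, inner_add_right, inner_sub_left, inner_sub_right]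
  ring

theorem surjective_of_norm_le_of_orthogonal_range {E H : Type*} [NormedAddCommGroup E]
    [NormedSpace ℂ E] [CompleteSpace E] [NormedAddCommGroup H] [InnerProductSpace ℂ H]
    [CompleteSpace H] (U : E →L[ℂ] H) (hU : ∀ x, ‖x‖ ≤ ‖U x‖)
    (horth : ∀ y, (∀ x, (⟪U x, y⟫ : ℂ) = 0) → y = 0) : Function.Surjective U := by
  have hanti : AntilipschitzWith 1 U := U.antilipschitz_of_bound (by simpa using hU)
  have hclosed : IsClosed (LinearMap.range (U : E →ₗ[ℂ] H) : Set H) := by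
    exact hanti.isClosed_range U.uniformContinuous
  have : CompleteSpace (LinearMap.range (U : E →ₗ[ℂ] H)) := hclosed.completeSpace_coe
  have htop : LinearMap.range (U : E →ₗ[ℂ] H) = ⊤ := by
    rw [← Submodule.orthogonal_eq_bot_iff, Submodule.eq_bot_iff]
    intro y hy
    exact horth y fun x => (Submodule.mem_orthogonal _ y).1 hy _ ⟨x, rfl⟩
  exact LinearMap.range_eq_top.1 htop

theorem exists_linearIsometryEquiv_of_flip_orthogonal {H : Type*} [NormedAddCommGroup H]
    [InnerProductSpace ℂ H] [CompleteSpace H] (C : Submodule ℂ (H × H))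
    (hC : ∀ p, p ∈ C ↔ ∀ c ∈ C, (⟪c.1, p.2⟫ : ℂ) + ⟪c.2, p.1⟫ = 0) :
    ∃ V : H ≃ₗᵢ[ℂ] H, ∀ p : H × H, p ∈ C ↔ p.1 + p.2 = V (p.1 - p.2) := by
  have hC' : ∀ p, p ∈ C ↔
      ∀ c ∈ C, (⟪c.1 + c.2, p.1 + p.2⟫ : ℂ) = ⟪c.1 - c.2, p.1 - p.2⟫ := by
    intro p
    rw [hC p]
    refine forall₂_congr fun c _ => ?_
    rw [← sub_eq_zero (a := (⟪c.1 + c.2, p.1 + p.2⟫ : ℂ)), inner_add_sub_inner_sub]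
    simp
  have hnorm : ∀ p ∈ C, ‖p.1 + p.2‖ = ‖p.1 - p.2‖ := by
    intro p hp
    have h := (hC' p).1 hp p hp
    rw [inner_self_eq_norm_sq_to_K, inner_self_eq_norm_sq_to_K] at h
    have h2 : ‖p.1 + p.2‖ ^ 2 = ‖p.1 - p.2‖ ^ 2 := by exact_mod_cast h
    exact (pow_left_inj₀ (norm_nonneg _) (norm_nonneg _) two_ne_zero).1 h2
  have hbound : ∀ p ∈ C, ‖p‖ ≤ ‖p.1 - p.2‖ := by
    intro p hp
    have hs := hnorm p hp
    have h1 : ‖(2 : ℂ) • p.1‖ ≤ ‖p.1 + p.2‖ + ‖p.1 - p.2‖ := by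
      rw [show (2 : ℂ) • p.1 = (p.1 + p.2) + (p.1 - p.2) by module]
      exact norm_add_le _ _
    have h2 : ‖(2 : ℂ) • p.2‖ ≤ ‖p.1 + p.2‖ + ‖p.1 - p.2‖ := by
      rw [show (2 : ℂ) • p.2 = (p.1 + p.2) - (p.1 - p.2) by module]
      exact norm_sub_le _ _
    rw [norm_smul, Complex.norm_ofNat] at h1 h2
    rw [Prod.norm_def]
    exact max_le (by linarith) (by linarith)
  have hclosed : IsClosed (C : Set (H × H)) := by
    have : (C : Set (H × H)) = ⋂ c ∈ C, {p | (⟪c.1, p.2⟫ : ℂ) + ⟪c.2, p.1⟫ = 0} := by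
      ext p
      simpa using hC p
    rw [this]
    exact isClosed_biInter fun c _ => isClosed_eq (by fun_prop) continuous_const
  have : CompleteSpace C := hclosed.completeSpace_coe
  let U : C →L[ℂ] H :=
    (ContinuousLinearMap.fst ℂ H H - ContinuousLinearMap.snd ℂ H H).comp C.subtypeL
  let W : C →L[ℂ] H :=
    (ContinuousLinearMap.fst ℂ H H + ContinuousLinearMap.snd ℂ H H).comp C.subtypeL
  have hUa : ∀ c : C, U c = c.1.1 - c.1.2 := fun _ => rfl
  have hWa : ∀ c : C, W c = c.1.1 + c.1.2 := fun _ => rfl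
  have hhalf : ∀ y : H, (2⁻¹ : ℂ) • y + (2⁻¹ : ℂ) • y = y := fun y => by
    rw [← add_smul]; norm_num
  have hUb : ∀ c : C, ‖c‖ ≤ ‖U c‖ := fun c => hbound c c.2
  have hWb : ∀ c : C, ‖c‖ ≤ ‖W c‖ := fun c => by
    rw [hWa, hnorm c c.2]; exact hbound c c.2
  have hUs : Function.Surjective U := by
    refine surjective_of_norm_le_of_orthogonal_range U hUb fun y hy => ?_
    have hmem : ((2⁻¹ : ℂ) • y, -((2⁻¹ : ℂ) • y)) ∈ C := by
      rw [hC']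
      intro c hc
      simpa [hhalf, hUa] using (hy ⟨c, hc⟩).symm
    simpa [hhalf, eq_comm] using hnorm _ hmem
  have hWs : Function.Surjective W := by
    refine surjective_of_norm_le_of_orthogonal_range W hWb fun y hy => ?_
    have hmem : ((2⁻¹ : ℂ) • y, (2⁻¹ : ℂ) • y) ∈ C := by
      rw [hC']
      intro c hc
      simpa [hhalf, hWa] using hy ⟨c, hc⟩
    simpa [hhalf] using hnorm _ hmem
  have hUi : Function.Injective U := (injective_iff_map_eq_zero U).2 fun c hc => by
    simpa [hc] using hUb c
  have hWi : Function.Injective W := (injective_iff_map_eq_zero W).2 fun c hc => by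
    simpa [hc] using hWb c
  let eU := LinearEquiv.ofBijective (U : C →ₗ[ℂ] H) ⟨hUi, hUs⟩
  let eW := LinearEquiv.ofBijective (W : C →ₗ[ℂ] H) ⟨hWi, hWs⟩
  have hV : ∀ c : C, (eU.symm.trans eW) (U c) = W c := fun c => by
    change eW (eU.symm (eU c)) = eW c
    rw [eU.symm_apply_apply]
  refine ⟨⟨eU.symm.trans eW, fun y => ?_⟩, fun p => ⟨fun hp => (hV ⟨p, hp⟩).symm, fun hp => ?_⟩⟩
  · obtain ⟨c, rfl⟩ := hUs y
    rw [hV]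
    exact hnorm c c.2
  · obtain ⟨c, hc⟩ := hUs (p.1 - p.2)
    change p.1 + p.2 = (eU.symm.trans eW) (p.1 - p.2) at hp
    rw [← hc, hV, hWa] at hp
    rw [hUa] at hc
    have h1 : (2 : ℂ) • p.1 = (2 : ℂ) • c.1.1 := by
      linear_combination (norm := module) hp - hc
    have h2 : (2 : ℂ) • p.2 = (2 : ℂ) • c.1.2 := by
      linear_combination (norm := module) hp + hc
    have : p = c.1 := Prod.ext (smul_right_injective H (two_ne_zero' ℂ) h1)
      (smul_right_injective H (two_ne_zero' ℂ) h2)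
    rw [this]
    exact c.2

/-- A linear relation is the flip of its orthogonal complement iff it is the kernel of
`[1 + V, 1 - V]` for a unitary `V`. -/
theorem flip_orthogonal_iff_exists_unitary {H : Type*} [NormedAddCommGroup H]
    [InnerProductSpace ℂ H] [CompleteSpace H] (C : Submodule ℂ (H × H)) :
    (∀ p, p ∈ C ↔ ∀ c ∈ C, (⟪c.1, p.2⟫ : ℂ) + ⟪c.2, p.1⟫ = 0) ↔
      ∃ V : H →L[ℂ] H, V ∈ unitary (H →L[ℂ] H) ∧
        (C : Set (H × H)) = {p : H × H | (1 + V) p.1 + (1 - V) p.2 = 0} := by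
  have hker : ∀ (V : H →L[ℂ] H) (p : H × H),
      (1 + V) p.1 + (1 - V) p.2 = 0 ↔ p.1 + p.2 = -V (p.1 - p.2) := by
    intro V p
    rw [← sub_eq_zero (a := p.1 + p.2)]
    simp only [add_apply, sub_apply, one_apply_eq_self, map_sub]
    rw [show p.1 + V p.1 + (p.2 - V p.2) = p.1 + p.2 - -(V p.1 - V p.2) by abel]
  constructor
  · intro hC
    obtain ⟨V, hV⟩ := exists_linearIsometryEquiv_of_flip_orthogonal C hC
    refine ⟨-((Unitary.linearIsometryEquiv.symm V : unitary (H →L[ℂ] H)) : H →L[ℂ] H),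
      (-(Unitary.linearIsometryEquiv.symm V)).2, ?_⟩
    ext p
    rw [Set.mem_ofPred_eq, hker, SetLike.mem_coe, hV]
    simp
  · rintro ⟨V, hV, hCV⟩ p
    have hmem : ∀ p, p ∈ C ↔ p.1 + p.2 = -V (p.1 - p.2) := fun p => by
      rw [← hker, ← SetLike.mem_coe, hCV, Set.mem_ofPred_eq]
    have hform : ∀ c ∈ C, (⟪c.1, p.2⟫ + ⟪c.2, p.1⟫ = (0 : ℂ)) ↔
        (⟪V (c.1 - c.2), p.1 + p.2 + V (p.1 - p.2)⟫ : ℂ) = 0 := by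
      intro c hc
      have h := inner_add_sub_inner_sub c p
      rw [(hmem c).1 hc, inner_neg_left] at h
      rw [inner_add_right, V.inner_map_map_of_mem_unitary hV]
      constructor
      · intro h0
        linear_combination -h - 2 * h0
      · intro h0
        linear_combination -(1 / 2 : ℂ) * h - (1 / 2 : ℂ) * h0
    rw [hmem, eq_neg_iff_add_eq_zero]
    constructor
    · intro hp c hc
      rw [hform c hc, hp, inner_zero_right]
    · intro h
      set z := p.1 + p.2 + V (p.1 - p.2) with hz
      set u := (star V) z
      have hVu : V u = z := by
        have := congrArg (fun T : H →L[ℂ] H => T z) (Unitary.mul_star_self_of_mem hV)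
        simpa using this
      have hhalf : (2⁻¹ : ℂ) • u + (2⁻¹ : ℂ) • u = u := by rw [← add_smul]; norm_num
      have hhalf' : (2⁻¹ : ℂ) • z + (2⁻¹ : ℂ) • z = z := by rw [← add_smul]; norm_num
      let c : H × H := ((2⁻¹ : ℂ) • u - (2⁻¹ : ℂ) • z, -((2⁻¹ : ℂ) • u) - (2⁻¹ : ℂ) • z)
      have hsub : c.1 - c.2 = u := by
        change ((2⁻¹ : ℂ) • u - (2⁻¹ : ℂ) • z) - (-((2⁻¹ : ℂ) • u) - (2⁻¹ : ℂ) • z) = u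
        linear_combination (norm := module) hhalf
      have hadd : c.1 + c.2 = -z := by
        change ((2⁻¹ : ℂ) • u - (2⁻¹ : ℂ) • z) + (-((2⁻¹ : ℂ) • u) - (2⁻¹ : ℂ) • z) = -z
        linear_combination (norm := module) -hhalf'
      have hc : c ∈ C := by rw [hmem, hsub, hadd, hVu]
      have := (hform c hc).1 (h c hc)
      rwa [hsub, hVu, inner_self_eq_zero] at this

theorem inner_add_inner_eq_zero_of_re_inner_self {X : Type*} [NormedAddCommGroup X]
    [InnerProductSpace ℂ X] (T : X →ₗ.[ℂ] X)
    (hT : ∀ x : T.domain, (⟪T x, (x : X)⟫ : ℂ).re = 0) (x y : T.domain) :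
    (⟪T x, (y : X)⟫ : ℂ) + ⟪(x : X), T y⟫ = 0 := by
  have key : ∀ x y : T.domain, ((⟪T x, (y : X)⟫ : ℂ) + ⟪(x : X), T y⟫).re = 0 := by
    intro x y
    have h := hT (x + y)
    rw [LinearPMap.map_add, Submodule.coe_add, inner_add_left, inner_add_right, inner_add_right]
      at h
    have hs : (⟪(x : X), T y⟫ : ℂ).re = (⟪T y, (x : X)⟫ : ℂ).re :=
      inner_re_symm (𝕜 := ℂ) _ _
    have hx := hT x
    have hy := hT y
    simp only [Complex.add_re] at h ⊢
    linarith
  apply Complex.ext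
  · exact key x y
  · have h := key x (Complex.I • y)
    rw [LinearPMap.map_smul, Submodule.coe_smul, inner_smul_right, inner_smul_right,
      ← mul_add] at h
    simpa [← neg_add_rev, add_comm] using h

namespace BoundaryTriplet

variable {X : Type*} [NormedAddCommGroup X] [InnerProductSpace ℂ X] [CompleteSpace X]
  {B : Type*} [NormedAddCommGroup B] [InnerProductSpace ℂ B] {A₀ : X →ₗ.[ℂ] X}

/-- The minimal domain lies in the common kernel of the boundary maps. -/
theorem mem_ker_of_mem_domain (hdense : Dense (A₀.domain : Set X))
    (hskew : ∀ x : A₀.domain, (⟪A₀ x, (x : X)⟫ : ℂ).re = 0)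
    (BT : BoundaryTriplet B A₀.adjoint) (x : A₀.domain) :
    ∃ x' : A₀.adjoint.domain, (x' : X) = x ∧ A₀.adjoint x' = -A₀ x ∧
      x' ∈ LinearMap.ker BT.B₁ ⊓ LinearMap.ker BT.B₂ := by
  have hle : -A₀ ≤ A₀.adjoint := by
    refine LinearPMap.IsFormalAdjoint.le_adjoint hdense fun u v => ?_
    have h := inner_add_inner_eq_zero_of_re_inner_self A₀ hskew u v
    rw [LinearPMap.neg_apply, inner_neg_right]
    exact eq_neg_of_add_eq_zero_left h
  let x' : A₀.adjoint.domain := ⟨x, hle.1 x.2⟩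
  have hx' : A₀.adjoint x' = -A₀ x := (hle.2 (x := x) (y := x') rfl).symm
  have hzero : ∀ y, (⟪BT.B₁ x', BT.B₂ y⟫ : ℂ) + ⟪BT.B₂ x', BT.B₁ y⟫ = 0 := by
    intro y
    rw [← BT.green, hx', inner_neg_left]
    have := (LinearPMap.adjoint_isFormalAdjoint hdense).symm x y
    rw [this]
    exact neg_add_cancel _
  refine ⟨x', rfl, hx', ?_⟩
  obtain ⟨y, hy⟩ := BT.surjective (BT.B₂ x', BT.B₁ x')
  obtain ⟨hy1, hy2⟩ := Prod.mk.inj hy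
  have h := hzero y
  rw [hy1, hy2, inner_self_eq_norm_sq_to_K, inner_self_eq_norm_sq_to_K] at h
  have h2 : ‖BT.B₁ x'‖ ^ 2 + ‖BT.B₂ x'‖ ^ 2 = 0 := Complex.ofReal_injective (by simpa using h)
  constructor
  · refine LinearMap.mem_ker.2 (norm_eq_zero.1 ?_)
    nlinarith [sq_nonneg ‖BT.B₁ x'‖, sq_nonneg ‖BT.B₂ x'‖]
  · refine LinearMap.mem_ker.2 (norm_eq_zero.1 ?_)
    nlinarith [sq_nonneg ‖BT.B₁ x'‖, sq_nonneg ‖BT.B₂ x'‖]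

theorem adjoint_eq_neg_iff (hdense : Dense (A₀.domain : Set X))
    (hskew : ∀ x : A₀.domain, (⟪A₀ x, (x : X)⟫ : ℂ).re = 0)
    (BT : BoundaryTriplet B A₀.adjoint) (D : Submodule ℂ A₀.adjoint.domain)
    (hD : LinearMap.ker BT.B₁ ⊓ LinearMap.ker BT.B₂ ≤ D) (A : X →ₗ.[ℂ] X)
    (hA : A = A₀.adjoint.domRestrict (D.map A₀.adjoint.domain.subtype)) :
    A.adjoint = -A ↔ ∀ y : A₀.adjoint.domain, y ∈ D ↔
      ∀ d ∈ D, (⟪BT.B₁ d, BT.B₂ y⟫ : ℂ) + ⟪BT.B₂ d, BT.B₁ y⟫ = 0 := by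
  have hdom : ∀ y : A₀.adjoint.domain, (y : X) ∈ A.domain ↔ y ∈ D := by
    intro y
    rw [hA, LinearPMap.domRestrict_domain]
    constructor
    · rintro ⟨⟨d, hd, hdy⟩, -⟩
      rwa [← Subtype.ext hdy]
    · exact fun hy => ⟨⟨y, hy, rfl⟩, y.2⟩
  have hle : A ≤ A₀.adjoint := hA ▸ LinearPMap.domRestrict_le
  have hdenseA : Dense (A.domain : Set X) := by
    refine hdense.mono fun x hx => ?_
    obtain ⟨x', hx', -, hker⟩ := mem_ker_of_mem_domain hdense hskew BT ⟨x, hx⟩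
    change x ∈ A.domain
    rw [← show (x' : X) = x from hx', hdom]
    exact hD hker
  have hadj : ∀ y : A.adjoint.domain, ∃ y' : A₀.adjoint.domain, (y' : X) = y ∧
      A₀.adjoint y' = -A.adjoint y := by
    intro y
    have hy : ∀ x : A₀.domain, (⟪-A.adjoint y, (x : X)⟫ : ℂ) = ⟪(y : X), A₀ x⟫ := by
      intro x
      obtain ⟨x', hx', hAx', hker⟩ := mem_ker_of_mem_domain hdense hskew BT x
      have hxA : (x : X) ∈ A.domain := by rw [← hx', hdom]; exact hD hker
      have h := LinearPMap.adjoint_isFormalAdjoint hdenseA y ⟨x, hxA⟩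
      rw [hle.2 (x := ⟨x, hxA⟩) (y := x') hx'.symm, hAx', inner_neg_right] at h
      rw [inner_neg_left, h, neg_neg]
    let y' : A₀.adjoint.domain := ⟨y, LinearPMap.mem_adjoint_domain_of_exists _ ⟨_, hy⟩⟩
    exact ⟨y', rfl, LinearPMap.adjoint_apply_eq hdense y' hy⟩
  have hadjdom : ∀ y : A₀.adjoint.domain, (y : X) ∈ A.adjoint.domain ↔
      ∀ d ∈ D, (⟪BT.B₁ d, BT.B₂ y⟫ : ℂ) + ⟪BT.B₂ d, BT.B₁ y⟫ = 0 := by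
    intro y
    constructor
    · intro hy d hd
      obtain ⟨y', hy', hAy'⟩ := hadj ⟨y, hy⟩
      obtain rfl : y' = y := Subtype.ext hy'
      have h := (LinearPMap.adjoint_isFormalAdjoint hdenseA).symm ⟨d, (hdom d).2 hd⟩ ⟨y', hy⟩
      rw [hle.2 (x := ⟨d, (hdom d).2 hd⟩) (y := d) rfl] at h
      rw [← BT.green, hAy', inner_neg_right, h]
      exact add_neg_cancel _
    · intro h
      refine LinearPMap.mem_adjoint_domain_of_exists _ ⟨-A₀.adjoint y, fun x => ?_⟩
      let d : A₀.adjoint.domain := ⟨x, hle.1 x.2⟩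
      have hd := h d ((hdom d).1 x.2)
      rw [← BT.green] at hd
      rw [hle.2 (x := x) (y := d) rfl, inner_neg_left, ← inner_conj_symm, ← inner_conj_symm (y : X),
        neg_eq_iff_add_eq_zero, ← map_add, add_comm]
      exact (congrArg (starRingEnd ℂ) hd).trans (map_zero _)
  constructor
  · intro h y
    rw [← hadjdom, h, LinearPMap.neg_domain, hdom]
  · intro h
    have hiff : ∀ y : A₀.adjoint.domain, (y : X) ∈ A.adjoint.domain ↔ (y : X) ∈ A.domain :=
      fun y => by rw [hadjdom, hdom, h]
    refine LinearPMap.dExt ?_ fun x y hxy => ?_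
    · ext x
      constructor
      · intro hx
        obtain ⟨y', hy', -⟩ := hadj ⟨x, hx⟩
        change (y' : X) = x at hy'
        subst hy'
        exact (hiff y').1 hx
      · intro hx
        exact (hiff ⟨x, hle.1 hx⟩).2 hx
    · obtain ⟨y', hy', hAy'⟩ := hadj x
      rw [LinearPMap.neg_apply]
      have : A y = A₀.adjoint y' := hle.2 (x := y) (y := y') (hxy.symm.trans hy'.symm)
      rw [this, hAy', neg_neg]

theorem mem_iff_boundary_mem (BT : BoundaryTriplet B A₀.adjoint)
    (D : Submodule ℂ A₀.adjoint.domain)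
    (hD : LinearMap.ker BT.B₁ ⊓ LinearMap.ker BT.B₂ ≤ D) (y : A₀.adjoint.domain) :
    y ∈ D ↔ (BT.B₁ y, BT.B₂ y) ∈ D.map (BT.B₁.prod BT.B₂) := by
  constructor
  · exact fun hy => ⟨y, hy, rfl⟩
  · rintro ⟨d, hd, hdy⟩
    obtain ⟨h1, h2⟩ := Prod.mk.inj hdy
    have hk : y - d ∈ D := hD ⟨by simp [h1], by simp [h2]⟩
    simpa using D.add_mem hk hd

theorem adjoint_eq_neg_iff_flip_orthogonal (hdense : Dense (A₀.domain : Set X))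
    (hskew : ∀ x : A₀.domain, (⟪A₀ x, (x : X)⟫ : ℂ).re = 0)
    (BT : BoundaryTriplet B A₀.adjoint) (D : Submodule ℂ A₀.adjoint.domain)
    (hD : LinearMap.ker BT.B₁ ⊓ LinearMap.ker BT.B₂ ≤ D) (A : X →ₗ.[ℂ] X)
    (hA : A = A₀.adjoint.domRestrict (D.map A₀.adjoint.domain.subtype))
    (C : Submodule ℂ (B × B)) (hC : C = D.map (BT.B₁.prod BT.B₂)) :
    A.adjoint = -A ↔ ∀ p, p ∈ C ↔ ∀ c ∈ C, (⟪c.1, p.2⟫ : ℂ) + ⟪c.2, p.1⟫ = 0 := by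
  rw [adjoint_eq_neg_iff hdense hskew BT D hD A hA, BT.surjective.forall]
  refine forall_congr' fun y => ?_
  rw [mem_iff_boundary_mem BT D hD y, hC]
  refine iff_congr Iff.rfl ⟨?_, fun h d hd => h _ ⟨d, hd, rfl⟩⟩
  rintro h _ ⟨d, hd, rfl⟩
  exact h d hd

end BoundaryTriplet

/-- With `A` the restriction of `A₀*` to `𝓓 ⊇ ker B₁ ∩ ker B₂` and
`𝓒 := {(B₁ d, B₂ d) : d ∈ 𝓓}`: `A` is skew-adjoint (`A* = −A`) iff `𝓒` equals the image
of `𝓒^⊥` under the coordinate flip `(q, p) ↦ (p, q)`, iff `𝓒 = ker [I + V, I − V]` for some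
unitary `V` on `𝓑`. -/
theorem statement4
    {X : Type*} [NormedAddCommGroup X] [InnerProductSpace ℂ X] [CompleteSpace X]
    {B : Type*} [NormedAddCommGroup B] [InnerProductSpace ℂ B] [CompleteSpace B]
    (A₀ : X →ₗ.[ℂ] X) (hdense : Dense (A₀.domain : Set X)) (hclosed : A₀.IsClosed)
    (hskew : ∀ x : A₀.domain, (⟪A₀ x, (x : X)⟫ : ℂ).re = 0)
    (BT : BoundaryTriplet B A₀.adjoint)
    (𝓓 : Submodule ℂ A₀.adjoint.domain)
    (h𝓓 : LinearMap.ker BT.B₁ ⊓ LinearMap.ker BT.B₂ ≤ 𝓓)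
    (A : X →ₗ.[ℂ] X)
    (hA : A = A₀.adjoint.domRestrict (𝓓.map A₀.adjoint.domain.subtype))
    (𝓒 : Submodule ℂ (B × B)) (h𝓒 : 𝓒 = 𝓓.map (BT.B₁.prod BT.B₂)) :
    (A.adjoint = -A ↔
        𝓒 = Submodule.map (LinearEquiv.prodComm ℂ B B : B × B →ₗ[ℂ] B × B) (prodOrth 𝓒)) ∧
      (A.adjoint = -A ↔
        ∃ V : B →L[ℂ] B, V ∈ unitary (B →L[ℂ] B) ∧
          (𝓒 : Set (B × B)) = {p : B × B | (1 + V) p.1 + (1 - V) p.2 = 0}) := by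
  have h := BT.adjoint_eq_neg_iff_flip_orthogonal hdense hskew 𝓓 h𝓓 A hA 𝓒 h𝓒
  refine ⟨h.trans ?_, h.trans (flip_orthogonal_iff_exists_unitary 𝓒)⟩
  rw [SetLike.ext_iff]
  exact forall_congr' fun p => by rw [mem_map_prodComm_prodOrth]
end
end

section
/- Let (𝓑; B₁, B₂) be a boundary triplet for A₀*, let 𝓚 be a Hilbert space, let W₁, W₂ ∈ 𝓛(𝓑; 𝓚) be bounded, and let A := A₀*|_{dom(A)} with dom(A) = { x ∈ dom(A₀*) : W₁B₁x + W₂B₂x = 0 }. Then the Hilbert-space adjoint of A is A* = −A₀*|_{dom(A*)}, where dom(A*) = { x ∈ dom(A₀*) : (B₁x, B₂x) ∈ cl({ (W₂*k, W₁*k) : k ∈ 𝓚 }) }, the closure being taken in 𝓑 × 𝓑. -/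
open scoped ComplexInnerProductSpace

noncomputable section

/-- The product closure of `{(W₂† k, W₁† k)}` is the annihilator of `{(v, u) : W₁ u + W₂ v = 0}`. -/
theorem mem_topologicalClosure_range_adjoint_prod_iff
    {B : Type*} [NormedAddCommGroup B] [InnerProductSpace ℂ B] [CompleteSpace B]
    {K : Type*} [NormedAddCommGroup K] [InnerProductSpace ℂ K] [CompleteSpace K]
    (W₁ W₂ : B →L[ℂ] K) (a b : B) :
    (a, b) ∈ (LinearMap.range (((ContinuousLinearMap.adjoint W₂ : K →L[ℂ] B) : K →ₗ[ℂ] B).prod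
        ((ContinuousLinearMap.adjoint W₁ : K →L[ℂ] B) : K →ₗ[ℂ] B))).topologicalClosure ↔
      ∀ u v : B, W₁ u + W₂ v = 0 → ⟪a, v⟫ + ⟪b, u⟫ = 0 := by
  let L := WithLp.prodContinuousLinearEquiv 2 ℂ B B
  let T : WithLp 2 (B × B) →L[ℂ] K := (W₂.coprod W₁).comp (L : WithLp 2 (B × B) →L[ℂ] B × B)
  have hadj (k : K) : ContinuousLinearMap.adjoint T k =
      L.symm (ContinuousLinearMap.adjoint W₂ k, ContinuousLinearMap.adjoint W₁ k) := by
    refine ext_inner_right ℂ fun p => ?_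
    rw [ContinuousLinearMap.adjoint_inner_left]
    simp [T, L, WithLp.prod_inner_apply, inner_add_right, ContinuousLinearMap.adjoint_inner_left]
  constructor
  · intro h u v huv
    have hclosed : IsClosed {p : B × B | ⟪p.1, v⟫ + ⟪p.2, u⟫ = 0} :=
      isClosed_eq (by fun_prop) continuous_const
    refine closure_minimal ?_ hclosed h
    rintro _ ⟨k, rfl⟩
    change (⟪ContinuousLinearMap.adjoint W₂ k, v⟫ + ⟪ContinuousLinearMap.adjoint W₁ k, u⟫ : ℂ) = 0
    rw [ContinuousLinearMap.adjoint_inner_left, ContinuousLinearMap.adjoint_inner_left,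
      ← inner_add_right, add_comm, huv, inner_zero_right]
  · intro h
    have hmem : L.symm (a, b) ∈
        (LinearMap.range (ContinuousLinearMap.adjoint T : K →ₗ[ℂ] _)).topologicalClosure := by
      rw [← ContinuousLinearMap.orthogonal_ker, Submodule.mem_orthogonal']
      intro p hker
      simpa [L, WithLp.prod_inner_apply] using
        h p.snd p.fst (by simpa [T, L, add_comm] using hker)
    rw [← L.apply_symm_apply (a, b)]
    refine map_mem_closure L.continuous hmem ?_
    rintro _ ⟨k, rfl⟩
    exact ⟨k, by simp [hadj]⟩

/-- A skew-symmetric operator satisfies the polarised identity. -/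
theorem LinearPMap.inner_eq_neg_of_re_inner_self_eq_zero
    {X : Type*} [NormedAddCommGroup X] [InnerProductSpace ℂ X] (A : X →ₗ.[ℂ] X)
    (hskew : ∀ x : A.domain, (⟪A x, (x : X)⟫ : ℂ).re = 0) (x y : A.domain) :
    (⟪A x, (y : X)⟫ : ℂ) = -⟪(x : X), A y⟫ := by
  have key (z w : A.domain) : (⟪A z, (w : X)⟫ + ⟪(z : X), A w⟫ : ℂ).re = 0 := by
    have h := hskew (z + w)
    simp only [A.map_add, Submodule.coe_add, inner_add_left, inner_add_right, Complex.add_re,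
      hskew z, hskew w] at h
    have hc : (⟪(z : X), A w⟫ : ℂ).re = (⟪A w, (z : X)⟫ : ℂ).re := inner_re_symm (𝕜 := ℂ) _ _
    rw [Complex.add_re, hc]
    linarith
  have h1 := key x y
  have h2 := key x (Complex.I • y)
  rw [A.map_smul, Submodule.coe_smul, inner_smul_right, inner_smul_right, ← mul_add,
    Complex.I_mul_re] at h2
  rw [eq_neg_iff_add_eq_zero]
  exact Complex.ext h1 (neg_eq_zero.1 h2)

/-- The boundary maps of a triplet vanish on the minimal operator. -/
theorem BoundaryTriplet.exists_mem_ker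
    {X : Type*} [NormedAddCommGroup X] [InnerProductSpace ℂ X] [CompleteSpace X]
    {B : Type*} [NormedAddCommGroup B] [InnerProductSpace ℂ B]
    {A₀ : X →ₗ.[ℂ] X} (hdense : Dense (A₀.domain : Set X))
    (hskew : ∀ x : A₀.domain, (⟪A₀ x, (x : X)⟫ : ℂ).re = 0)
    (BT : BoundaryTriplet B A₀.adjoint) (x : A₀.domain) :
    ∃ z : A₀.adjoint.domain, (z : X) = x ∧ A₀.adjoint z = -A₀ x ∧ BT.B₁ z = 0 ∧ BT.B₂ z = 0 := by
  have hw (y : A₀.domain) : (⟪-A₀ x, (y : X)⟫ : ℂ) = ⟪(x : X), A₀ y⟫ := by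
    rw [inner_neg_left, A₀.inner_eq_neg_of_re_inner_self_eq_zero hskew, neg_neg]
  let z : A₀.adjoint.domain := ⟨x, LinearPMap.mem_adjoint_domain_of_exists _ ⟨_, hw⟩⟩
  have hz : A₀.adjoint z = -A₀ x := LinearPMap.adjoint_apply_eq hdense z hw
  have hgreen (u v : B) : (⟪BT.B₁ z, v⟫ + ⟪BT.B₂ z, u⟫ : ℂ) = 0 := by
    obtain ⟨y, hy⟩ := BT.surjective (u, v)
    obtain ⟨rfl, rfl⟩ := Prod.mk.inj hy
    rw [← BT.green, hz, inner_neg_left,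
      ← (LinearPMap.adjoint_isFormalAdjoint hdense).symm x y]
    exact neg_add_cancel _
  refine ⟨z, rfl, hz, ?_, ?_⟩
  · simpa using hgreen 0 (BT.B₁ z)
  · simpa using hgreen (BT.B₂ z) 0

/-- Membership in the domain of a restriction to the image of a submodule of the domain. -/
theorem LinearPMap.mem_domain_domRestrict_map_subtype_iff
    {R E F : Type*} [Ring R] [AddCommGroup E] [Module R E] [AddCommGroup F] [Module R F]
    (T : E →ₗ.[R] F) (S : Submodule R T.domain) (x : E) :
    x ∈ (T.domRestrict (S.map T.domain.subtype)).domain ↔ ∃ z ∈ S, (z : E) = x := by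
  simp [LinearPMap.domRestrict_domain]

/-- With `A` the restriction of `A₀*` to `{x : W₁ B₁ x + W₂ B₂ x = 0}`,
the adjoint is `A* = −A₀*` restricted to
`{x ∈ dom A₀* : (B₁ x, B₂ x) ∈ cl {(W₂* k, W₁* k) : k ∈ 𝓚}}`. -/
theorem statement8
    {X : Type*} [NormedAddCommGroup X] [InnerProductSpace ℂ X] [CompleteSpace X]
    {B : Type*} [NormedAddCommGroup B] [InnerProductSpace ℂ B] [CompleteSpace B]
    {K : Type*} [NormedAddCommGroup K] [InnerProductSpace ℂ K] [CompleteSpace K]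
    (A₀ : X →ₗ.[ℂ] X) (hdense : Dense (A₀.domain : Set X)) (hclosed : A₀.IsClosed)
    (hskew : ∀ x : A₀.domain, (⟪A₀ x, (x : X)⟫ : ℂ).re = 0)
    (BT : BoundaryTriplet B A₀.adjoint)
    (W₁ W₂ : B →L[ℂ] K)
    (A : X →ₗ.[ℂ] X)
    (hA : A = A₀.adjoint.domRestrict
      ((LinearMap.ker ((W₁ : B →ₗ[ℂ] K) ∘ₗ BT.B₁ + (W₂ : B →ₗ[ℂ] K) ∘ₗ BT.B₂)).map
        A₀.adjoint.domain.subtype))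
    (𝓓adj : Submodule ℂ A₀.adjoint.domain)
    (h𝓓adj : 𝓓adj = Submodule.comap (BT.B₁.prod BT.B₂)
      (LinearMap.range (((ContinuousLinearMap.adjoint W₂ : K →L[ℂ] B) : K →ₗ[ℂ] B).prod
        ((ContinuousLinearMap.adjoint W₁ : K →L[ℂ] B) : K →ₗ[ℂ] B))).topologicalClosure) :
    A.adjoint = (-A₀.adjoint).domRestrict (𝓓adj.map A₀.adjoint.domain.subtype) := by
  have hAdom (x : X) : x ∈ A.domain ↔
      ∃ z : A₀.adjoint.domain, W₁ (BT.B₁ z) + W₂ (BT.B₂ z) = 0 ∧ (z : X) = x := by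
    rw [hA, LinearPMap.mem_domain_domRestrict_map_subtype_iff]
    simp
  have hAval (x : A.domain) (z : A₀.adjoint.domain) (h : (x : X) = z) : A x = A₀.adjoint z := by
    subst hA
    exact LinearPMap.domRestrict_apply h
  have hker (x : A₀.domain) : ∃ y : A.domain, (y : X) = x ∧ A y = -A₀ x := by
    obtain ⟨z, hzx, hz, h1, h2⟩ := BT.exists_mem_ker hdense hskew x
    have hmem : (x : X) ∈ A.domain := (hAdom _).2 ⟨z, by simp [h1, h2], hzx⟩
    exact ⟨⟨x, hmem⟩, rfl, (hAval _ z hzx.symm).trans hz⟩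
  have hAdense : Dense (A.domain : Set X) := hdense.mono fun x hx => by
    obtain ⟨y, hy, -⟩ := hker ⟨x, hx⟩
    exact Set.mem_of_eq_of_mem hy.symm y.2
  have h𝓓 (z : A₀.adjoint.domain) : z ∈ 𝓓adj ↔
      ∀ x : A₀.adjoint.domain, W₁ (BT.B₁ x) + W₂ (BT.B₂ x) = 0 →
        (⟪A₀.adjoint z, (x : X)⟫ + ⟪(z : X), A₀.adjoint x⟫ : ℂ) = 0 := by
    rw [h𝓓adj, Submodule.mem_comap]
    refine (mem_topologicalClosure_range_adjoint_prod_iff W₁ W₂ _ _).trans ⟨fun h x hx => ?_,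
      fun h u v huv => ?_⟩
    · rw [BT.green]
      exact h _ _ hx
    · obtain ⟨x, hx⟩ := BT.surjective (u, v)
      obtain ⟨rfl, rfl⟩ := Prod.mk.inj hx
      rw [← BT.green]
      exact h x huv
  have hle : (-A₀.adjoint).domRestrict (𝓓adj.map A₀.adjoint.domain.subtype) ≤ A.adjoint := by
    refine LinearPMap.IsFormalAdjoint.le_adjoint hAdense fun x y => ?_
    obtain ⟨z, hz, hzx⟩ := (hAdom x).1 x.2
    obtain ⟨w, hw, hwy⟩ :=
      ((-A₀.adjoint).mem_domain_domRestrict_map_subtype_iff 𝓓adj (y : X)).1 y.2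
    have hy : (-A₀.adjoint).domRestrict (𝓓adj.map A₀.adjoint.domain.subtype) y =
        -A₀.adjoint w :=
      LinearPMap.domRestrict_apply (f := -A₀.adjoint) (y := w) hwy.symm
    rw [hAval x z hzx.symm, hy, ← hzx, ← hwy, inner_neg_right, eq_neg_iff_add_eq_zero,
      ← inner_conj_symm, ← inner_conj_symm (z : X), ← map_add, add_comm]
    rw [(h𝓓 w).1 hw z hz, map_zero]
  refine (LinearPMap.eq_of_le_of_domain_eq hle (le_antisymm hle.1 fun y hy => ?_)).symm
  have hfa := LinearPMap.adjoint_isFormalAdjoint hAdense ⟨y, hy⟩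
  have hw (x : A₀.domain) : (⟪-A.adjoint ⟨y, hy⟩, (x : X)⟫ : ℂ) = ⟪y, A₀ x⟫ := by
    obtain ⟨x', hx', hAx'⟩ := hker x
    rw [inner_neg_left, ← hx', hfa x', hAx', inner_neg_right, neg_neg]
  let z : A₀.adjoint.domain := ⟨y, LinearPMap.mem_adjoint_domain_of_exists _ ⟨_, hw⟩⟩
  have hz : A₀.adjoint z = -A.adjoint ⟨y, hy⟩ := LinearPMap.adjoint_apply_eq hdense z hw
  refine ((-A₀.adjoint).mem_domain_domRestrict_map_subtype_iff 𝓓adj y).2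
    ⟨z, (h𝓓 z).2 fun x hx => ?_, rfl⟩
  have hxA : (x : X) ∈ A.domain := (hAdom _).2 ⟨x, hx, rfl⟩
  rw [hz, inner_neg_left, ← hAval ⟨x, hxA⟩ x rfl]
  exact neg_add_eq_zero.2 (hfa ⟨x, hxA⟩)
end
end

section
/- Let (𝓑; B₁, B₂) be a boundary triplet for A₀*, let 𝓚 be a Hilbert space, let W₁, W₂ ∈ 𝓛(𝓑; 𝓚) be bounded, and let A := A₀*|_{dom(A)} with dom(A) = { x ∈ dom(A₀*) : W₁B₁x + W₂B₂x = 0 }. Then A generates a unitary group on X (equivalently, since A is closed and densely defined: A is skew-adjoint, A* = −A) if and only if A is skew-symmetric (Re⟨Ax, x⟩_X = 0 for all x ∈ dom(A)) and W₁W₂* + W₂W₁* = 0 in 𝓚. -/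
open scoped ComplexInnerProductSpace

noncomputable section

/-- Polarization: a linear operator with `Re ⟪Sx, x⟫ = 0` on its domain is skew-symmetric as a
sesquilinear form. -/
theorem LinearPMap.inner_add_inner_eq_zero_of_re_inner_self_eq_zero
    {X : Type*} [NormedAddCommGroup X] [InnerProductSpace ℂ X] {S : X →ₗ.[ℂ] X}
    (hS : ∀ x : S.domain, (⟪S x, (x : X)⟫ : ℂ).re = 0) (x y : S.domain) :
    ⟪S x, (y : X)⟫ + ⟪(x : X), S y⟫ = 0 := by
  have re_zero (x y : S.domain) : (⟪S x, (y : X)⟫ + ⟪(x : X), S y⟫ : ℂ).re = 0 := by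
    have h := hS (x + y)
    rw [LinearPMap.map_add, Submodule.coe_add, inner_add_left, inner_add_right, inner_add_right]
      at h
    have hsymm : (⟪(x : X), S y⟫ : ℂ).re = (⟪S y, (x : X)⟫ : ℂ).re := inner_re_symm (𝕜 := ℂ) _ _
    simp only [Complex.add_re] at h ⊢
    linarith [hS x, hS y]
  apply Complex.ext
  · exact re_zero x y
  · have h := re_zero x (Complex.I • y)
    rw [LinearPMap.map_smul, Submodule.coe_smul, inner_smul_right, inner_smul_right, ← mul_add,
      Complex.I_mul_re] at h
    simp only [Complex.add_im, Complex.zero_im, neg_eq_zero] at h ⊢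
    exact h

namespace BoundaryTriplet

section Restrict

variable {X : Type*} [NormedAddCommGroup X] [InnerProductSpace ℂ X]
  {B : Type*} [NormedAddCommGroup B] [InnerProductSpace ℂ B]
  {K : Type*} [NormedAddCommGroup K] [InnerProductSpace ℂ K] {T : X →ₗ.[ℂ] X}

/-- The restriction of `T` to the vectors satisfying the boundary condition
`W₁ B₁ x + W₂ B₂ x = 0`. -/
def restrict (BT : BoundaryTriplet B T) (W₁ W₂ : B →L[ℂ] K) : X →ₗ.[ℂ] X :=
  T.domRestrict
    ((LinearMap.ker ((W₁ : B →ₗ[ℂ] K) ∘ₗ BT.B₁ + (W₂ : B →ₗ[ℂ] K) ∘ₗ BT.B₂)).map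
      T.domain.subtype)

variable (BT : BoundaryTriplet B T) (W₁ W₂ : B →L[ℂ] K)

theorem mem_restrict_domain {x : X} :
    x ∈ (BT.restrict W₁ W₂).domain ↔
      ∃ h : x ∈ T.domain, W₁ (BT.B₁ ⟨x, h⟩) + W₂ (BT.B₂ ⟨x, h⟩) = 0 := by
  simp only [restrict, LinearPMap.domRestrict_domain, Submodule.mem_inf, Submodule.mem_map,
    LinearMap.mem_ker]
  constructor
  · rintro ⟨⟨⟨y, hy⟩, hker, rfl⟩, h⟩
    exact ⟨h, hker⟩
  · rintro ⟨h, hker⟩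
    exact ⟨⟨⟨x, h⟩, hker, rfl⟩, h⟩

theorem restrict_apply {x : X} (hx : x ∈ (BT.restrict W₁ W₂).domain) (h : x ∈ T.domain) :
    BT.restrict W₁ W₂ ⟨x, hx⟩ = T ⟨x, h⟩ :=
  LinearPMap.domRestrict_apply rfl

/-- A vector on which all boundary pairings vanish has trivial boundary values. -/
theorem boundary_eq_zero {y : T.domain}
    (hy : ∀ x : T.domain, ⟪T x, (y : X)⟫ + ⟪(x : X), T y⟫ = 0) : BT.B₁ y = 0 ∧ BT.B₂ y = 0 := by
  obtain ⟨x, hx⟩ := BT.surjective (BT.B₂ y, BT.B₁ y)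
  obtain ⟨hx₁, hx₂⟩ := Prod.mk.inj hx
  have h := congrArg Complex.re ((BT.green x y).symm.trans (hy x))
  rw [hx₁, hx₂, Complex.add_re, Complex.zero_re] at h
  have h₁ : 0 ≤ (⟪BT.B₁ y, BT.B₁ y⟫ : ℂ).re := inner_self_nonneg (𝕜 := ℂ)
  have h₂ : 0 ≤ (⟪BT.B₂ y, BT.B₂ y⟫ : ℂ).re := inner_self_nonneg (𝕜 := ℂ)
  exact ⟨re_inner_self_nonpos (𝕜 := ℂ).mp (show (⟪BT.B₁ y, BT.B₁ y⟫ : ℂ).re ≤ 0 by linarith),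
    re_inner_self_nonpos (𝕜 := ℂ).mp (show (⟪BT.B₂ y, BT.B₂ y⟫ : ℂ).re ≤ 0 by linarith)⟩

end Restrict

section Adjoint

variable {X : Type*} [NormedAddCommGroup X] [InnerProductSpace ℂ X] [CompleteSpace X]
  {B : Type*} [NormedAddCommGroup B] [InnerProductSpace ℂ B]
  {K : Type*} [NormedAddCommGroup K] [InnerProductSpace ℂ K] {A₀ : X →ₗ.[ℂ] X}

/-- A skew-symmetric `A₀` satisfies `-A₀ ≤ A`, where `A` is any restriction of `A₀*` by a
boundary condition. -/
theorem neg_le_restrict (hdense : Dense (A₀.domain : Set X))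
    (hskew : ∀ x : A₀.domain, (⟪A₀ x, (x : X)⟫ : ℂ).re = 0)
    (BT : BoundaryTriplet B A₀.adjoint) (W₁ W₂ : B →L[ℂ] K) :
    -A₀ ≤ BT.restrict W₁ W₂ := by
  have formal : A₀.IsFormalAdjoint (-A₀) := fun x y => by
    rw [LinearPMap.neg_apply, inner_neg_right]
    exact eq_neg_of_add_eq_zero_left
      (LinearPMap.inner_add_inner_eq_zero_of_re_inner_self_eq_zero hskew x y)
  have le := formal.le_adjoint hdense
  refine ⟨fun y hy => ?_, fun x y hxy => ?_⟩
  · have hy' := le.1 hy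
    have hval : A₀.adjoint ⟨y, hy'⟩ = -A₀ ⟨y, hy⟩ := (le.2 (x := ⟨y, hy⟩) rfl).symm
    obtain ⟨h₁, h₂⟩ := BT.boundary_eq_zero (y := ⟨y, hy'⟩) fun x => by
      rw [hval, inner_neg_right, A₀.adjoint_isFormalAdjoint hdense x ⟨y, hy⟩, add_neg_cancel]
    exact (BT.mem_restrict_domain W₁ W₂).mpr ⟨hy', by simp [h₁, h₂]⟩
  · obtain ⟨y, hy⟩ := y
    obtain ⟨h, -⟩ := (BT.mem_restrict_domain W₁ W₂).mp hy
    rw [BT.restrict_apply W₁ W₂ hy h]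
    exact le.2 hxy

theorem dense_restrict_domain (hdense : Dense (A₀.domain : Set X))
    (hskew : ∀ x : A₀.domain, (⟪A₀ x, (x : X)⟫ : ℂ).re = 0)
    (BT : BoundaryTriplet B A₀.adjoint) (W₁ W₂ : B →L[ℂ] K) :
    Dense ((BT.restrict W₁ W₂).domain : Set X) :=
  hdense.mono (BT.neg_le_restrict hdense hskew W₁ W₂).1

/-- The adjoint of a restriction of `A₀*` is contained in `-A₀*`. -/
theorem adjoint_restrict_le (hdense : Dense (A₀.domain : Set X))
    (hskew : ∀ x : A₀.domain, (⟪A₀ x, (x : X)⟫ : ℂ).re = 0)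
    (BT : BoundaryTriplet B A₀.adjoint) (W₁ W₂ : B →L[ℂ] K) :
    (BT.restrict W₁ W₂).adjoint ≤ -A₀.adjoint := by
  have hle := BT.neg_le_restrict hdense hskew W₁ W₂
  have hA := BT.dense_restrict_domain hdense hskew W₁ W₂
  have inner_eq (y : (BT.restrict W₁ W₂).adjoint.domain) (x : A₀.domain) :
      ⟪-(BT.restrict W₁ W₂).adjoint y, (x : X)⟫ = ⟪(y : X), A₀ x⟫ := by
    have h := (BT.restrict W₁ W₂).adjoint_isFormalAdjoint hA y ⟨x, hle.1 x.2⟩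
    rw [← hle.2 (x := x) rfl, LinearPMap.neg_apply, inner_neg_right] at h
    rw [inner_neg_left, h, neg_neg]
  refine ⟨fun y hy => A₀.mem_adjoint_domain_of_exists y ⟨_, inner_eq ⟨y, hy⟩⟩, fun y z hyz => ?_⟩
  rw [LinearPMap.neg_apply, A₀.adjoint_apply_eq hdense z (x₀ := -(BT.restrict W₁ W₂).adjoint y)
    fun x => by rw [inner_eq y x, hyz], neg_neg]

/-- The boundary values of a vector in the domain of the adjoint of a restriction of `A₀*` are
exactly those pairing to zero with every pair satisfying the boundary condition. -/
theorem mem_adjoint_restrict_domain (hdense : Dense (A₀.domain : Set X))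
    (hskew : ∀ x : A₀.domain, (⟪A₀ x, (x : X)⟫ : ℂ).re = 0)
    (BT : BoundaryTriplet B A₀.adjoint) (W₁ W₂ : B →L[ℂ] K) {y : X} :
    y ∈ (BT.restrict W₁ W₂).adjoint.domain ↔
      ∃ h : y ∈ A₀.adjoint.domain, ∀ u v : B, W₁ u + W₂ v = 0 →
        ⟪u, BT.B₂ ⟨y, h⟩⟫ + ⟪v, BT.B₁ ⟨y, h⟩⟫ = 0 := by
  have hA := BT.dense_restrict_domain hdense hskew W₁ W₂
  constructor
  · intro hy
    have hle := BT.adjoint_restrict_le hdense hskew W₁ W₂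
    have h : y ∈ A₀.adjoint.domain := hle.1 hy
    refine ⟨h, fun u v huv => ?_⟩
    obtain ⟨⟨x, hx⟩, hxuv⟩ := BT.surjective (u, v)
    obtain ⟨rfl, rfl⟩ := Prod.mk.inj hxuv
    have hxA := (BT.mem_restrict_domain W₁ W₂).mpr ⟨hx, huv⟩
    have hadj := ((BT.restrict W₁ W₂).adjoint_isFormalAdjoint hA).symm ⟨x, hxA⟩ ⟨y, hy⟩
    rw [hle.2 (x := ⟨y, hy⟩) (y := ⟨y, h⟩) rfl, LinearPMap.neg_apply,
      BT.restrict_apply W₁ W₂ hxA hx, inner_neg_right] at hadj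
    rw [← BT.green, hadj, neg_add_cancel]
  · rintro ⟨h, hpair⟩
    refine LinearPMap.mem_adjoint_domain_of_exists _ ⟨-A₀.adjoint ⟨y, h⟩, ?_⟩
    rintro ⟨x, hxA⟩
    obtain ⟨hx, hker⟩ := (BT.mem_restrict_domain W₁ W₂).mp hxA
    have hgreen := BT.green ⟨x, hx⟩ ⟨y, h⟩
    rw [hpair _ _ hker] at hgreen
    have hconj := congrArg (starRingEnd ℂ) hgreen
    rw [map_add, inner_conj_symm, inner_conj_symm, map_zero] at hconj
    rw [BT.restrict_apply W₁ W₂ hxA hx, inner_neg_left]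
    exact (eq_neg_of_add_eq_zero_left hconj).symm

end Adjoint

end BoundaryTriplet

/-- With `A` the restriction of `A₀*` to `{x : W₁ B₁ x + W₂ B₂ x = 0}`,
`A` generates a unitary group (equivalently, being closed and densely defined, `A` is
skew-adjoint, `A* = −A`) iff `A` is skew-symmetric and `W₁ W₂* + W₂ W₁* = 0`. -/
theorem statement11
    {X : Type*} [NormedAddCommGroup X] [InnerProductSpace ℂ X] [CompleteSpace X]
    {B : Type*} [NormedAddCommGroup B] [InnerProductSpace ℂ B] [CompleteSpace B]
    {K : Type*} [NormedAddCommGroup K] [InnerProductSpace ℂ K] [CompleteSpace K]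
    (A₀ : X →ₗ.[ℂ] X) (hdense : Dense (A₀.domain : Set X)) (hclosed : A₀.IsClosed)
    (hskew : ∀ x : A₀.domain, (⟪A₀ x, (x : X)⟫ : ℂ).re = 0)
    (BT : BoundaryTriplet B A₀.adjoint)
    (W₁ W₂ : B →L[ℂ] K)
    (A : X →ₗ.[ℂ] X)
    (hA : A = A₀.adjoint.domRestrict
      ((LinearMap.ker ((W₁ : B →ₗ[ℂ] K) ∘ₗ BT.B₁ + (W₂ : B →ₗ[ℂ] K) ∘ₗ BT.B₂)).map
        A₀.adjoint.domain.subtype))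
    : A.adjoint = -A ↔
        ((∀ x : A.domain, (⟪A x, (x : X)⟫ : ℂ).re = 0) ∧
          W₁.comp (ContinuousLinearMap.adjoint W₂) +
            W₂.comp (ContinuousLinearMap.adjoint W₁) = 0) := by
  obtain rfl : A = BT.restrict W₁ W₂ := hA
  have hle := BT.adjoint_restrict_le hdense hskew W₁ W₂
  have hA := BT.dense_restrict_domain hdense hskew W₁ W₂
  constructor
  · intro hadj
    constructor
    · intro x
      have hx : (x : X) ∈ (BT.restrict W₁ W₂).adjoint.domain := by rw [hadj]; exact x.2
      have hval : (BT.restrict W₁ W₂).adjoint ⟨x, hx⟩ = -BT.restrict W₁ W₂ x :=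
        hadj.le.2 (x := ⟨x, hx⟩) (y := x) rfl
      have h := (BT.restrict W₁ W₂).adjoint_isFormalAdjoint hA ⟨x, hx⟩ x
      rw [hval, inner_neg_left] at h
      have hre := congrArg Complex.re h
      have hsymm : (⟪(x : X), BT.restrict W₁ W₂ x⟫ : ℂ).re =
        (⟪BT.restrict W₁ W₂ x, (x : X)⟫ : ℂ).re := inner_re_symm (𝕜 := ℂ) _ _
      rw [Complex.neg_re] at hre
      linarith
    · ext k
      obtain ⟨⟨y, hy⟩, hyk⟩ := BT.surjective
        (ContinuousLinearMap.adjoint W₂ k, ContinuousLinearMap.adjoint W₁ k)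
      obtain ⟨hy₁, hy₂⟩ := Prod.mk.inj hyk
      have hmem : y ∈ (BT.restrict W₁ W₂).adjoint.domain := by
        refine (BT.mem_adjoint_restrict_domain hdense hskew W₁ W₂).mpr ⟨hy, fun u v huv => ?_⟩
        rw [hy₁, hy₂, ContinuousLinearMap.adjoint_inner_right,
          ContinuousLinearMap.adjoint_inner_right, ← inner_add_left, huv, inner_zero_left]
      rw [hadj] at hmem
      obtain ⟨_, hker⟩ := (BT.mem_restrict_domain W₁ W₂).mp hmem
      rw [hy₁, hy₂] at hker
      exact hker
  · rintro ⟨hskewA, hW⟩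
    have domain_eq : (BT.restrict W₁ W₂).adjoint.domain = (-BT.restrict W₁ W₂).domain := by
      ext y
      rw [LinearPMap.neg_domain, BT.mem_adjoint_restrict_domain hdense hskew,
        BT.mem_restrict_domain]
      refine exists_congr fun h => ⟨fun hpair => ?_, fun hker u v huv => ?_⟩
      · refine ext_inner_left ℂ fun k => ?_
        have hk : W₁ (ContinuousLinearMap.adjoint W₂ k) +
            W₂ (ContinuousLinearMap.adjoint W₁ k) = 0 := congrArg (fun L => L k) hW
        rw [inner_zero_right, inner_add_right, ← ContinuousLinearMap.adjoint_inner_left,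
          ← ContinuousLinearMap.adjoint_inner_left, add_comm]
        exact hpair _ _ hk
      · obtain ⟨⟨x, hx⟩, hxuv⟩ := BT.surjective (u, v)
        obtain ⟨rfl, rfl⟩ := Prod.mk.inj hxuv
        have hxA := (BT.mem_restrict_domain W₁ W₂).mpr ⟨hx, huv⟩
        have hyA := (BT.mem_restrict_domain W₁ W₂).mpr ⟨h, hker⟩
        have hzero := LinearPMap.inner_add_inner_eq_zero_of_re_inner_self_eq_zero hskewA
          ⟨x, hxA⟩ ⟨y, hyA⟩
        rw [BT.restrict_apply W₁ W₂ hxA hx, BT.restrict_apply W₁ W₂ hyA h] at hzero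
        rw [← BT.green, hzero]
    refine LinearPMap.ext domain_eq fun y hy hy' => ?_
    obtain ⟨h, -⟩ := (BT.mem_restrict_domain W₁ W₂).mp hy'
    rw [hle.2 (x := ⟨y, hy⟩) (y := ⟨y, h⟩) rfl, LinearPMap.neg_apply]
    exact congrArg Neg.neg (BT.restrict_apply W₁ W₂ hy' h).symm
end
end
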